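/- Let F be an infinite field with char F ≠ 2 and let n ≥ 1. Let a = (α_1), b = (β_1), c = (γ_1, …, γ_r) be sequences of positive integers with sums at most n, with α_1 ≤ β_1, and with β_1 ≤ γ_1 in the case r = 1. If the set of G-orbits on M_a × M_b × M_c under the diagonal action of G = O_{2n+1}(F) is finite, then one of the following holds: (I) α_1 = β_1 = n; (II) α_1 = 1; (III) r = 1 and γ_1 = n; (IV) r = 2 and β_1 = n. -/

import Mathlib

open Module

/-- The symmetric bilinear form on `F^N` given by `(e_i, e_j) = δ_{i, N+1-j}`
(in 1-indexed notation), i.e. `(u, v) = ∑ i, u i * v (rev i)`. -/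
def bform (F : Type*) [Field F] (N : ℕ) (u v : Fin N → F) : F :=
  ∑ i, u i * v i.rev

/-- `g` belongs to the split orthogonal group `O_N(F)`. -/
def IsOrthMap (F : Type*) [Field F] (N : ℕ)
    (g : (Fin N → F) ≃ₗ[F] (Fin N → F)) : Prop :=
  ∀ u v, bform F N (g u) (g v) = bform F N u v

/-- A subspace `V` is isotropic if `(V, V) = {0}`. -/
def IsIsotropic (F : Type*) [Field F] (N : ℕ) (V : Submodule F (Fin N → F)) : Prop :=
  ∀ u ∈ V, ∀ v ∈ V, bform F N u v = 0

/-- A flag of type `a = (a 0, …, a (p-1))` in `F^{2n+1}` : an increasing chain of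
subspaces `V 0 ⊆ ⋯ ⊆ V (p-1)` with `dim (V i) = a 0 + ⋯ + a i` which is isotropic
(equivalently, by monotonicity, whose top member is isotropic). -/
def IsFlag (F : Type*) [Field F] (n p : ℕ) (a : Fin p → ℕ)
    (V : Fin p → Submodule F (Fin (2*n+1) → F)) : Prop :=
  Monotone V ∧ (∀ i : Fin p, finrank F (V i) = ∑ j ∈ Finset.Iic i, a j) ∧
    ∀ i : Fin p, IsIsotropic F (2*n+1) (V i)

/-- The flag variety `M_a`. -/
def FlagVar (F : Type*) [Field F] (n p : ℕ) (a : Fin p → ℕ) :=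
  { V : Fin p → Submodule F (Fin (2*n+1) → F) // IsFlag F n p a V }

/-- The orbit relation of the diagonal action of `O_{2n+1}(F)` on the triple flag
variety `M_a × M_b × M_c`. -/
def TripleRel (F : Type*) [Field F] (n p q r : ℕ)
    (a : Fin p → ℕ) (b : Fin q → ℕ) (c : Fin r → ℕ)
    (x y : FlagVar F n p a × FlagVar F n q b × FlagVar F n r c) : Prop :=
  ∃ g : (Fin (2*n+1) → F) ≃ₗ[F] (Fin (2*n+1) → F), IsOrthMap F (2*n+1) g ∧
    (∀ i, Submodule.map g.toLinearMap (x.1.1 i) = y.1.1 i) ∧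
    (∀ i, Submodule.map g.toLinearMap (x.2.1.1 i) = y.2.1.1 i) ∧
    (∀ i, Submodule.map g.toLinearMap (x.2.2.1 i) = y.2.2.1 i)

section Orbits

variable {F : Type*} [Field F]

lemma bform_add_left (N : ℕ) (u u' v : Fin N → F) :
    bform F N (u + u') v = bform F N u v + bform F N u' v := by
  simp [bform, add_mul, Finset.sum_add_distrib]

lemma bform_smul_left (N : ℕ) (a : F) (u v : Fin N → F) :
    bform F N (a • u) v = a * bform F N u v := by
  simp [bform, mul_assoc, Finset.mul_sum]

lemma bform_add_right (N : ℕ) (u v v' : Fin N → F) :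
    bform F N u (v + v') = bform F N u v + bform F N u v' := by
  simp [bform, mul_add, Finset.sum_add_distrib]

lemma bform_smul_right (N : ℕ) (a : F) (u v : Fin N → F) :
    bform F N u (a • v) = a * bform F N u v := by
  simp [bform, mul_left_comm, Finset.mul_sum]

lemma bform_single_left (N : ℕ) (i : Fin N) (v : Fin N → F) :
    bform F N (Pi.single i 1) v = v i.rev := by
  simp [bform, Pi.single_apply]

/-- The span of the first `k` members of a finite sequence of vectors. -/
def stepSpan {V : Type*} [AddCommGroup V] [Module F V] {K : ℕ} (w : Fin K → V) (k : ℕ) :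
    Submodule F V :=
  Submodule.span F (w '' {j | j.val < k})

section stepSpan

variable {V : Type*} [AddCommGroup V] [Module F V]

lemma stepSpan_mono {K : ℕ} (w : Fin K → V) : Monotone (stepSpan (F := F) w) := by
  intro k l h
  exact Submodule.span_mono (Set.image_mono fun j hj => lt_of_lt_of_le hj h)

lemma mem_stepSpan {K : ℕ} {w : Fin K → V} {j : Fin K} {k : ℕ} (h : j.val < k) :
    w j ∈ stepSpan (F := F) w k :=
  Submodule.subset_span ⟨j, h, rfl⟩

lemma finrank_stepSpan {K : ℕ} {w : Fin K → V} (hw : LinearIndependent F w) {k : ℕ}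
    (hk : k ≤ K) : finrank F (stepSpan (F := F) w k) = k := by
  have h : w '' {j | j.val < k} = Set.range (w ∘ Fin.castLE hk) := by
    ext x
    constructor
    · rintro ⟨j, hj, rfl⟩
      exact ⟨⟨j, hj⟩, rfl⟩
    · rintro ⟨j, rfl⟩
      exact ⟨Fin.castLE hk j, j.isLt, rfl⟩
  rw [stepSpan, h, finrank_span_eq_card (hw.comp _ (Fin.castLE_injective hk)), Fintype.card_fin]

lemma mem_stepSpan_one {w : Fin 3 → V} {x : V} :
    x ∈ stepSpan (F := F) w 1 ↔ ∃ a : F, a • w 0 = x := by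
  have h : {j : Fin 3 | j.val < 1} = {0} := by
    ext j; fin_cases j <;> simp
  rw [stepSpan, h, Set.image_singleton, Submodule.mem_span_singleton]

lemma mem_stepSpan_two {w : Fin 3 → V} {x : V} :
    x ∈ stepSpan (F := F) w 2 ↔ ∃ a b : F, a • w 0 + b • w 1 = x := by
  have h : {j : Fin 3 | j.val < 2} = {0, 1} := by
    ext j; fin_cases j <;> simp
  rw [stepSpan, h, Set.image_pair, Submodule.mem_span_pair]

lemma mem_stepSpan_three {w : Fin 3 → V} {x : V} :
    x ∈ stepSpan (F := F) w 3 ↔ ∃ a b c : F, a • w 0 + b • w 1 + c • w 2 = x := by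
  have h : {j : Fin 3 | j.val < 3} = {0, 1, 2} := by
    ext j; fin_cases j <;> simp
  rw [stepSpan, h, Set.image_insert_eq, Set.image_pair, Submodule.mem_span_triple]

lemma stepSpan_isotropic {N K : ℕ} {w : Fin K → Fin N → F}
    (hw : ∀ i j, bform F N (w i) (w j) = 0) (k : ℕ) :
    IsIsotropic F N (stepSpan w k) := by
  intro u hu v hv
  induction hu using Submodule.span_induction with
  | mem u hu =>
    obtain ⟨i, -, rfl⟩ := hu
    induction hv using Submodule.span_induction with
    | mem v hv => obtain ⟨j, -, rfl⟩ := hv; exact hw i j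
    | zero => simp [bform]
    | add x y _ _ hx hy => rw [bform_add_right, hx, hy, add_zero]
    | smul a x _ hx => rw [bform_smul_right, hx, mul_zero]
  | zero => simp [bform]
  | add x y _ _ hx hy => rw [bform_add_left, hx, hy, add_zero]
  | smul a x _ hx => rw [bform_smul_left, hx, mul_zero]

end stepSpan

/-- The positions in `F^{2n+1}` of the three outer hyperbolic planes and the middle vector. -/
def coreIndex {n : ℕ} (hn : 3 ≤ n) (k : Fin 7) : Fin (2 * n + 1) :=
  ⟨if k.val < 3 then k.val else if k.val = 3 then n else 2 * n - 6 + k.val, by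
    split_ifs <;> omega⟩

lemma coreIndex_injective {n : ℕ} (hn : 3 ≤ n) : Function.Injective (coreIndex hn) := by
  intro k l h
  simp only [coreIndex, Fin.mk.injEq] at h
  ext
  split_ifs at h <;> omega

lemma coreIndex_rev {n : ℕ} (hn : 3 ≤ n) (k : Fin 7) :
    (coreIndex hn k).rev = coreIndex hn k.rev := by
  ext
  simp only [coreIndex, Fin.val_rev]
  split_ifs <;> omega

/-- The isometric embedding of `F^7` in `F^{2n+1}`. -/
def coreEmb (F : Type*) [Field F] {n : ℕ} (hn : 3 ≤ n) :
    (Fin 7 → F) →ₗ[F] (Fin (2 * n + 1) → F) :=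
  Fintype.linearCombination F fun k => Pi.single (coreIndex hn k) (1 : F)

/-- The restriction to the core coordinates. -/
def coreProj (F : Type*) [Field F] {n : ℕ} (hn : 3 ≤ n) :
    (Fin (2 * n + 1) → F) →ₗ[F] (Fin 7 → F) :=
  LinearMap.funLeft F F (coreIndex hn)

lemma coreProj_coreEmb {n : ℕ} (hn : 3 ≤ n) (x : Fin 7 → F) :
    coreProj F hn (coreEmb F hn x) = x := by
  ext k
  simp [coreProj, coreEmb, Fintype.linearCombination_apply, LinearMap.funLeft_apply,
    Finset.sum_apply, Pi.single_apply, (coreIndex_injective hn).eq_iff]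

lemma coreEmb_apply_of_notMem {n : ℕ} (hn : 3 ≤ n) (x : Fin 7 → F) {i : Fin (2 * n + 1)}
    (hi : ∀ k, i ≠ coreIndex hn k) : coreEmb F hn x i = 0 := by
  simp [coreEmb, Fintype.linearCombination_apply, Finset.sum_apply, hi]

lemma bform_coreEmb {n : ℕ} (hn : 3 ≤ n) (x : Fin 7 → F) (v : Fin (2 * n + 1) → F) :
    bform F (2 * n + 1) (coreEmb F hn x) v = bform F 7 x (coreProj F hn v) := by
  have h : coreEmb F hn x = ∑ k, x k • Pi.single (coreIndex hn k) (1 : F) := by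
    simp only [coreEmb, Fintype.linearCombination_apply]
  have hs : ∀ s : Finset (Fin 7), bform F (2 * n + 1)
      (∑ k ∈ s, x k • Pi.single (coreIndex hn k) (1 : F)) v =
        ∑ k ∈ s, x k * v (coreIndex hn k).rev := by
    intro s
    induction s using Finset.induction_on with
    | empty => simp [bform]
    | insert a s ha ih =>
      rw [Finset.sum_insert ha, Finset.sum_insert ha, bform_add_left, ih, bform_smul_left,
        bform_single_left]
  rw [h, hs]
  simp [bform, coreIndex_rev, coreProj, LinearMap.funLeft_apply]

/-- The isotropic basis vectors `e_4, …, e_n`, which are orthogonal to the core. -/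
def tailVec (F : Type*) [Field F] (n : ℕ) (j : Fin (n - 3)) : Fin (2 * n + 1) → F :=
  Pi.single ⟨3 + j.val, by omega⟩ 1

lemma tailVec_linearIndependent (n : ℕ) : LinearIndependent F (tailVec F n) := by
  have h := (Pi.basisFun F (Fin (2 * n + 1))).linearIndependent.comp
    (fun j : Fin (n - 3) => (⟨3 + j.val, by omega⟩ : Fin (2 * n + 1)))
    (by intro a b h; simp only [Fin.mk.injEq] at h; ext; omega)
  convert h using 1
  ext j i
  simp [tailVec]

/-- A subspace of the core, enlarged by the first `m` tail vectors. -/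
def extend {n : ℕ} (hn : 3 ≤ n) (Q : Submodule F (Fin 7 → F)) (m : ℕ) :
    Submodule F (Fin (2 * n + 1) → F) :=
  Q.map (coreEmb F hn) ⊔ stepSpan (tailVec F n) m

lemma coreProj_eq_zero_of_mem_tail {n : ℕ} (hn : 3 ≤ n) {m : ℕ} {e : Fin (2 * n + 1) → F}
    (he : e ∈ stepSpan (F := F) (tailVec F n) m) : coreProj F hn e = 0 := by
  have h : stepSpan (F := F) (tailVec F n) m ≤ LinearMap.ker (coreProj F hn) := by
    refine Submodule.span_le.2 ?_
    rintro _ ⟨j, -, rfl⟩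
    rw [SetLike.mem_coe, LinearMap.mem_ker]
    ext k
    simp only [coreProj, LinearMap.funLeft_apply, tailVec, Pi.single_apply, coreIndex,
      Fin.mk.injEq, Pi.zero_apply]
    split_ifs <;> first | rfl | omega
  exact h he

lemma mem_extend {n : ℕ} {hn : 3 ≤ n} {Q : Submodule F (Fin 7 → F)} {m : ℕ}
    {v : Fin (2 * n + 1) → F} (hv : v ∈ extend hn Q m) :
    coreProj F hn v ∈ Q ∧
      ∃ e ∈ stepSpan (F := F) (tailVec F n) m, v = coreEmb F hn (coreProj F hn v) + e := by
  obtain ⟨_, ⟨x, hx, rfl⟩, e, he, rfl⟩ := Submodule.mem_sup.1 hv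
  have h : coreProj F hn (coreEmb F hn x + e) = x := by
    rw [map_add, coreProj_coreEmb, coreProj_eq_zero_of_mem_tail hn he, add_zero]
  rw [h]
  exact ⟨hx, e, he, rfl⟩

lemma coreEmb_mem_extend {n : ℕ} {hn : 3 ≤ n} {Q : Submodule F (Fin 7 → F)} {x : Fin 7 → F}
    (hx : x ∈ Q) (m : ℕ) : coreEmb F hn x ∈ extend hn Q m :=
  Submodule.mem_sup_left (Submodule.mem_map_of_mem hx)

lemma apply_rev_eq_zero_of_mem_extend {n : ℕ} {hn : 3 ≤ n} {Q : Submodule F (Fin 7 → F)} {m : ℕ}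
    {v : Fin (2 * n + 1) → F} (hv : v ∈ extend hn Q m) (j : Fin (n - 3)) :
    v (⟨3 + j.val, by omega⟩ : Fin (2 * n + 1)).rev = 0 := by
  obtain ⟨-, e, he, h⟩ := mem_extend hv
  rw [h, Pi.add_apply, coreEmb_apply_of_notMem, zero_add]
  · have hle : stepSpan (F := F) (tailVec F n) m ≤
        LinearMap.ker (LinearMap.proj (R := F) (φ := fun _ : Fin (2 * n + 1) => F)
          (⟨3 + j.val, by omega⟩ : Fin (2 * n + 1)).rev) := by
      refine Submodule.span_le.2 ?_
      rintro _ ⟨l, -, rfl⟩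
      simp only [SetLike.mem_coe, LinearMap.mem_ker, LinearMap.proj_apply, tailVec,
        Pi.single_apply, Fin.ext_iff, Fin.val_rev]
      rw [if_neg (by omega)]
    exact hle he
  · intro k hk
    simp only [coreIndex, Fin.ext_iff, Fin.val_rev] at hk
    split_ifs at hk <;> omega

lemma bform_extend {n : ℕ} {hn : 3 ≤ n} {Q Q' : Submodule F (Fin 7 → F)} {m m' : ℕ}
    {u v : Fin (2 * n + 1) → F} (hu : u ∈ extend hn Q m) (hv : v ∈ extend hn Q' m') :
    bform F (2 * n + 1) u v = bform F 7 (coreProj F hn u) (coreProj F hn v) := by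
  obtain ⟨-, e, he, h⟩ := mem_extend hu
  have h0 : bform F (2 * n + 1) e v = 0 := by
    clear h
    induction he using Submodule.span_induction with
    | mem x hx =>
      obtain ⟨j, -, rfl⟩ := hx
      rw [tailVec, bform_single_left, apply_rev_eq_zero_of_mem_extend hv]
    | zero => simp [bform]
    | add x y _ _ hx hy => rw [bform_add_left, hx, hy, add_zero]
    | smul a x _ hx => rw [bform_smul_left, hx, mul_zero]
  conv_lhs => rw [h, bform_add_left, h0, add_zero, bform_coreEmb]

lemma finrank_extend {n : ℕ} (hn : 3 ≤ n) (Q : Submodule F (Fin 7 → F)) {m : ℕ}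
    (hm : m ≤ n - 3) : finrank F (extend hn Q m) = finrank F Q + m := by
  have hinj : Function.Injective (coreEmb F hn) :=
    Function.LeftInverse.injective (coreProj_coreEmb hn)
  have hinf : Q.map (coreEmb F hn) ⊓ stepSpan (F := F) (tailVec F n) m = ⊥ := by
    rw [Submodule.eq_bot_iff]
    rintro _ ⟨⟨x, -, rfl⟩, he⟩
    have h := coreProj_eq_zero_of_mem_tail hn he
    rw [coreProj_coreEmb] at h
    rw [h, map_zero]
  have hmap : finrank F (Q.map (coreEmb F hn)) = finrank F Q :=
    (Submodule.equivMapOfInjective _ hinj Q).finrank_eq.symm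
  have h := Submodule.finrank_sup_add_finrank_inf_eq (Q.map (coreEmb F hn))
    (stepSpan (F := F) (tailVec F n) m)
  rw [hinf, finrank_bot, add_zero, hmap,
    finrank_stepSpan (tailVec_linearIndependent (F := F) n) hm] at h
  exact h

/-- A maximal isotropic subspace of `F^7` given by a basis. -/
structure IsIsotropicBasis (w : Fin 3 → Fin 7 → F) : Prop where
  linearIndependent : LinearIndependent F w
  isotropic : ∀ i j, bform F 7 (w i) (w j) = 0

/-- The dimension of the core part of a `d`-dimensional member of a standard flag whose core part
grows after dimensions `0`, `s` and `t`. -/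
def coreDim (s t d : ℕ) : ℕ :=
  (if 0 < d then 1 else 0) + (if s < d then 1 else 0) + (if t < d then 1 else 0)

/-- The standard flag attached to a basis of a maximal isotropic subspace of the core. -/
def stdFlag {n r : ℕ} (hn : 3 ≤ n) (w : Fin 3 → Fin 7 → F) (s t : ℕ) (c : Fin r → ℕ) (i : Fin r) :
    Submodule F (Fin (2 * n + 1) → F) :=
  extend hn (stepSpan w (coreDim s t (∑ j ∈ Finset.Iic i, c j)))
    ((∑ j ∈ Finset.Iic i, c j) - coreDim s t (∑ j ∈ Finset.Iic i, c j))

lemma stdFlag_isFlag {n r : ℕ} (hn : 3 ≤ n) {w : Fin 3 → Fin 7 → F} (hw : IsIsotropicBasis w)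
    {s t : ℕ} (hs : 0 < s) (hst : s < t) (ht : t < n) {c : Fin r → ℕ} (hc : ∑ i, c i ≤ n) :
    IsFlag F n r c (stdFlag hn w s t c) := by
  refine ⟨fun i j hij => ?_, fun i => ?_, fun i u hu v hv => ?_⟩
  · have h : ∑ k ∈ Finset.Iic i, c k ≤ ∑ k ∈ Finset.Iic j, c k :=
      Finset.sum_le_sum_of_subset (Finset.Iic_subset_Iic.2 hij)
    refine sup_le_sup (Submodule.map_mono (stepSpan_mono w ?_)) (stepSpan_mono _ ?_) <;>
    · simp only [coreDim]
      split_ifs <;> omega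
  · have h : ∑ k ∈ Finset.Iic i, c k ≤ n :=
      (Finset.sum_le_sum_of_subset (Finset.subset_univ _)).trans hc
    rw [stdFlag, finrank_extend, finrank_stepSpan hw.linearIndependent] <;>
    · simp only [coreDim]
      split_ifs <;> omega
  · rw [bform_extend hu hv]
    exact stepSpan_isotropic hw.isotropic _ _ (mem_extend hu).1 _ (mem_extend hv).1

/-- A family of subspaces maps to another one, preserving the form, without losing the functionals
defined by the members of the target. -/
def FormMap {κ : Type*} {M N : ℕ} (V : κ → Submodule F (Fin M → F))
    (V' : κ → Submodule F (Fin N → F)) : Prop :=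
  ∃ f : (Fin M → F) → (Fin N → F), (∀ i, ∀ u ∈ V i, f u ∈ V' i) ∧
    (∀ i j, ∀ u ∈ V i, ∀ v ∈ V j, bform F N (f u) (f v) = bform F M u v) ∧
    ∀ j, ∀ v' ∈ V' j, ∃ v ∈ V j, ∀ i, ∀ u ∈ V i, bform F N (f u) v' = bform F M u v

lemma formMap_coreEmb {κ : Type*} {n : ℕ} (hn : 3 ≤ n) (Q : κ → Submodule F (Fin 7 → F))
    (m : κ → ℕ) : FormMap Q fun i => extend hn (Q i) (m i) := by
  refine ⟨coreEmb F hn, fun i u hu => coreEmb_mem_extend hu _, fun i j u _ v _ => ?_,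
    fun j v' hv' => ⟨coreProj F hn v', (mem_extend hv').1, fun i u _ => bform_coreEmb hn u v'⟩⟩
  rw [bform_coreEmb, coreProj_coreEmb]

lemma formMap_coreProj {κ : Type*} {n : ℕ} (hn : 3 ≤ n) (Q : κ → Submodule F (Fin 7 → F))
    (m : κ → ℕ) : FormMap (fun i => extend hn (Q i) (m i)) Q := by
  refine ⟨coreProj F hn, fun i u hu => (mem_extend hu).1,
    fun i j u hu v hv => (bform_extend hu hv).symm,
    fun j v' hv' => ⟨coreEmb F hn v', coreEmb_mem_extend hv' _, fun i u hu => ?_⟩⟩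
  rw [bform_extend hu (coreEmb_mem_extend (hn := hn) hv' (m j)), coreProj_coreEmb]

/-- The family of all subspaces occurring in a triple of flags. -/
def tripleFamily {n p q r : ℕ} {a : Fin p → ℕ} {b : Fin q → ℕ} {c : Fin r → ℕ}
    (x : FlagVar F n p a × FlagVar F n q b × FlagVar F n r c) :
    Fin p ⊕ Fin q ⊕ Fin r → Submodule F (Fin (2 * n + 1) → F) :=
  Sum.elim x.1.1 (Sum.elim x.2.1.1 x.2.2.1)

lemma TripleRel.formMap {n p q r : ℕ} {a : Fin p → ℕ} {b : Fin q → ℕ} {c : Fin r → ℕ}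
    {x y : FlagVar F n p a × FlagVar F n q b × FlagVar F n r c}
    (h : TripleRel F n p q r a b c x y) :
    FormMap (tripleFamily x) (tripleFamily y) ∧ FormMap (tripleFamily y) (tripleFamily x) := by
  obtain ⟨g, hg, h1, h2, h3⟩ := h
  have hmap : ∀ i, (tripleFamily x i).map g.toLinearMap = tripleFamily y i := by
    rintro (i | i | i)
    exacts [h1 i, h2 i, h3 i]
  have hmem : ∀ i, ∀ v ∈ tripleFamily y i, g.symm v ∈ tripleFamily x i := by
    intro i v hv
    rw [← hmap i] at hv
    obtain ⟨u, hu, rfl⟩ := hv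
    simpa using hu
  have hmem' : ∀ i, ∀ u ∈ tripleFamily x i, g u ∈ tripleFamily y i := by
    intro i u hu
    rw [← hmap i]
    exact Submodule.mem_map_of_mem hu
  refine ⟨⟨g, hmem', fun i j u _ v _ => hg u v, fun j v hv => ⟨g.symm v, hmem j v hv,
      fun i u _ => ?_⟩⟩, ⟨g.symm, hmem, fun i j u _ v _ => ?_, fun j v hv => ⟨g v, hmem' j v hv,
      fun i u _ => ?_⟩⟩⟩
  · rw [← hg u, g.apply_symm_apply]
  · rw [← hg (g.symm u), g.apply_symm_apply, g.apply_symm_apply]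
  · rw [← hg (g.symm u), g.apply_symm_apply]

/-- A one-parameter family of configurations of standard flags on which a property that is
transported by form-preserving maps detects the parameter meets infinitely many orbits. -/
theorem not_finite_orbits [Infinite F] {n r α β : ℕ} {c : Fin r → ℕ} (hn : 3 ≤ n)
    (hα : α ≤ n) (hβ : β ≤ n) (hc : ∑ i, c i ≤ n)
    {s t : ℕ} (hs : 0 < s) (hst : s < t) (ht : t < n)
    (u v w : F → Fin 3 → Fin 7 → F) (hu : ∀ l, IsIsotropicBasis (u l))
    (hv : ∀ l, IsIsotropicBasis (v l)) (hw : ∀ l, IsIsotropicBasis (w l))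
    (P : ∀ N : ℕ, F → (Fin 1 ⊕ Fin 1 ⊕ Fin r → Submodule F (Fin N → F)) → Prop)
    (hP : ∀ (M N : ℕ) (l : F) (V : Fin 1 ⊕ Fin 1 ⊕ Fin r → Submodule F (Fin M → F))
      (V' : Fin 1 ⊕ Fin 1 ⊕ Fin r → Submodule F (Fin N → F)),
      FormMap V V' → P M l V → P N l V')
    (hcore : ∀ l l', P 7 l' (Sum.elim (fun _ => stepSpan (u l) (coreDim 1 (n - 1) α))
      (Sum.elim (fun _ => stepSpan (v l) (coreDim 1 (n - 1) β))
        fun i => stepSpan (w l) (coreDim s t (∑ j ∈ Finset.Iic i, c j)))) ↔ l' = l) :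
    ¬ Finite (Quot (TripleRel F n 1 1 r ![α] ![β] c)) := by
  intro hfin
  have hflag : ∀ {x : Fin 3 → Fin 7 → F} (_ : IsIsotropicBasis x) {d : ℕ} (_ : d ≤ n),
      IsFlag F n 1 ![d] (stdFlag hn x 1 (n - 1) ![d]) := fun hx d hd =>
    stdFlag_isFlag hn hx one_pos (by omega) (by omega) (by simpa using hd)
  let f : F → FlagVar F n 1 ![α] × FlagVar F n 1 ![β] × FlagVar F n r c := fun l =>
    (⟨_, hflag (hu l) hα⟩, ⟨_, hflag (hv l) hβ⟩, ⟨_, stdFlag_isFlag hn (hw l) hs hst ht hc⟩)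
  let Φ : Quot (TripleRel F n 1 1 r ![α] ![β] c) → F → Prop :=
    Quot.lift (fun x l => P _ l (tripleFamily x)) fun x y h => by
      ext l
      exact ⟨hP _ _ _ _ _ h.formMap.1, hP _ _ _ _ _ h.formMap.2⟩
  have hΦ : ∀ l l', Φ (Quot.mk _ (f l)) l' ↔ l' = l := by
    intro l l'
    rw [← hcore l l']
    let Q : Fin 1 ⊕ Fin 1 ⊕ Fin r → Submodule F (Fin 7 → F) :=
      Sum.elim (fun _ => stepSpan (u l) (coreDim 1 (n - 1) α))
      (Sum.elim (fun _ => stepSpan (v l) (coreDim 1 (n - 1) β))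
        fun i => stepSpan (w l) (coreDim s t (∑ j ∈ Finset.Iic i, c j)))
    let m : Fin 1 ⊕ Fin 1 ⊕ Fin r → ℕ :=
      Sum.elim (fun _ => α - coreDim 1 (n - 1) α) (Sum.elim (fun _ => β - coreDim 1 (n - 1) β)
        fun i => (∑ j ∈ Finset.Iic i, c j) - coreDim s t (∑ j ∈ Finset.Iic i, c j))
    have hsum : ∀ (d : ℕ) (i : Fin 1), ∑ j ∈ Finset.Iic i, (![d] : Fin 1 → ℕ) j = d := by
      intro d i
      rw [Subsingleton.elim i 0]
      rfl
    have hfam : tripleFamily (f l) = fun i => extend hn (Q i) (m i) := by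
      ext1 i
      rcases i with i | i | i
      · simp only [tripleFamily, f, Q, m, Sum.elim_inl, stdFlag, hsum]
      · simp only [tripleFamily, f, Q, m, Sum.elim_inl, Sum.elim_inr, stdFlag, hsum]
      · rfl
    change P _ l' (tripleFamily (f l)) ↔ P 7 l' Q
    rw [hfam]
    exact ⟨hP _ _ _ _ _ (formMap_coreProj hn Q m), hP _ _ _ _ _ (formMap_coreEmb hn Q m)⟩
  have hinj : Function.Injective fun l => (Quot.mk (TripleRel F n 1 1 r ![α] ![β] c) (f l)) := by
    intro l l' h
    have h1 := (hΦ l l).2 rfl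
    have h2 : Quot.mk (TripleRel F n 1 1 r ![α] ![β] c) (f l) = Quot.mk _ (f l') := h
    rw [h2] at h1
    exact (hΦ l' l).1 h1
  have : Finite F := Finite.of_injective _ hinj
  exact not_finite F

/-- The basis vectors `e_1, e_2, e_3` of `F^7`. -/
def lowerBasis (F : Type*) [Field F] : Fin 3 → Fin 7 → F :=
  ![![1, 0, 0, 0, 0, 0, 0], ![0, 1, 0, 0, 0, 0, 0], ![0, 0, 1, 0, 0, 0, 0]]

/-- The basis vectors `e_7, e_6, e_5` of `F^7`, dual to `e_1, e_2, e_3`. -/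
def upperBasis (F : Type*) [Field F] : Fin 3 → Fin 7 → F :=
  ![![0, 0, 0, 0, 0, 0, 1], ![0, 0, 0, 0, 0, 1, 0], ![0, 0, 0, 0, 1, 0, 0]]

lemma bform_seven (u v : Fin 7 → F) : bform F 7 u v =
    u 0 * v 6 + u 1 * v 5 + u 2 * v 4 + u 3 * v 3 + u 4 * v 2 + u 5 * v 1 + u 6 * v 0 := by
  simp only [bform, Fin.sum_univ_seven]
  rfl

lemma isIsotropicBasis_of {w : Fin 3 → Fin 7 → F}
    (hli : ∀ a b c : F, a • w 0 + b • w 1 + c • w 2 = 0 → a = 0 ∧ b = 0 ∧ c = 0)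
    (h00 : bform F 7 (w 0) (w 0) = 0) (h01 : bform F 7 (w 0) (w 1) = 0)
    (h02 : bform F 7 (w 0) (w 2) = 0) (h11 : bform F 7 (w 1) (w 1) = 0)
    (h12 : bform F 7 (w 1) (w 2) = 0) (h22 : bform F 7 (w 2) (w 2) = 0) :
    IsIsotropicBasis w where
  linearIndependent := by
    rw [Fintype.linearIndependent_iff]
    intro g hg
    rw [Fin.sum_univ_three] at hg
    obtain ⟨h0, h1, h2⟩ := hli _ _ _ hg
    intro i
    fin_cases i
    exacts [h0, h1, h2]
  isotropic := by
    have hsymm : ∀ u v : Fin 7 → F, bform F 7 u v = bform F 7 v u := fun u v => by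
      simp only [bform_seven]; ring
    intro i j
    fin_cases i <;> fin_cases j
    exacts [h00, h01, h02, (hsymm _ _).trans h01, h11, h12, (hsymm _ _).trans h02,
      (hsymm _ _).trans h12, h22]

lemma isIsotropicBasis_lowerBasis : IsIsotropicBasis (lowerBasis F) := by
  refine isIsotropicBasis_of (fun a b c h => ?_) ?_ ?_ ?_ ?_ ?_ ?_
  · have h0 := congrFun h 0
    have h1 := congrFun h 1
    have h2 := congrFun h 2
    simp [lowerBasis] at h0 h1 h2
    exact ⟨h0, h1, h2⟩
  all_goals simp [lowerBasis, bform_seven]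

lemma isIsotropicBasis_upperBasis : IsIsotropicBasis (upperBasis F) := by
  refine isIsotropicBasis_of (fun a b c h => ?_) ?_ ?_ ?_ ?_ ?_ ?_
  · have h0 := congrFun h 6
    have h1 := congrFun h 5
    have h2 := congrFun h 4
    simp [upperBasis] at h0 h1 h2
    exact ⟨h0, h1, h2⟩
  all_goals simp [upperBasis, bform_seven]

/-- The third subspace, viewed as the graph of a bilinear form on the first one through the second
one, has a two-dimensional part whose discriminant is determined by `l`. -/
def GraphDiscr (N : ℕ) (l : F) (V₁ V₂ W : Submodule F (Fin N → F)) : Prop :=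
  ∃ u ∈ V₁, ∃ u' ∈ V₁, ∃ w ∈ W, ∃ w' ∈ W,
    (∀ x ∈ V₂, bform F N w x = bform F N u x) ∧ (∀ x ∈ V₂, bform F N w' x = bform F N u' x) ∧
    bform F N u w' - bform F N u' w ≠ 0 ∧
    4 * (bform F N u w * bform F N u' w' - bform F N u w' * bform F N u' w) =
      (2 * l + 1) * (bform F N u w' - bform F N u' w) ^ 2

lemma GraphDiscr.map {κ : Type*} {M N : ℕ} {V : κ → Submodule F (Fin M → F)}
    {V' : κ → Submodule F (Fin N → F)} (h : FormMap V V') {l : F} {i j k : κ}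
    (hV : GraphDiscr M l (V i) (V j) (V k)) : GraphDiscr N l (V' i) (V' j) (V' k) := by
  obtain ⟨f, hmem, hform, hback⟩ := h
  obtain ⟨u, hu, u', hu', w, hw, w', hw', h1, h2, h3, h4⟩ := hV
  refine ⟨f u, hmem _ _ hu, f u', hmem _ _ hu', f w, hmem _ _ hw, f w', hmem _ _ hw',
    fun x hx => ?_, fun x hx => ?_, ?_, ?_⟩
  · obtain ⟨y, hy, hxy⟩ := hback _ x hx
    rw [hxy _ _ hu, hxy _ _ hw, h1 y hy]
  · obtain ⟨y, hy, hxy⟩ := hback _ x hx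
    rw [hxy _ _ hu', hxy _ _ hw', h2 y hy]
  · rwa [hform _ _ _ hu _ hw', hform _ _ _ hu' _ hw]
  · rwa [hform _ _ _ hu _ hw', hform _ _ _ hu' _ hw, hform _ _ _ hu _ hw, hform _ _ _ hu' _ hw']

/-- A basis spanning the graph of a bilinear form with parameter `l`. -/
def graphBasis (l : F) : Fin 3 → Fin 7 → F :=
  ![![1, 0, 0, 2, 0, -1, -2], ![0, 1, 1, 0, l, -l, 1], ![0, 0, 0, 0, -1, 1, 0]]

lemma isIsotropicBasis_graphBasis (l : F) : IsIsotropicBasis (graphBasis l) := by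
  refine isIsotropicBasis_of (fun a b c h => ?_) ?_ ?_ ?_ ?_ ?_ ?_
  · have h0 := congrFun h 0
    have h1 := congrFun h 1
    have h2 := congrFun h 4
    simp [graphBasis] at h0 h1 h2
    subst h0 h1
    simpa using h2
  all_goals (simp [graphBasis, bform_seven]; try ring)

lemma graphDiscr_graphBasis (h2 : (2 : F) ≠ 0) (l l' : F) :
    GraphDiscr 7 l' (stepSpan (lowerBasis F) 2) (stepSpan (upperBasis F) 2)
      (stepSpan (graphBasis l) 2) ↔ l' = l := by
  constructor
  · rintro ⟨u, hu, u', hu', w, hw, w', hw', hwu, hwu', hne, heq⟩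
    obtain ⟨a, b, rfl⟩ := mem_stepSpan_two.1 hu
    obtain ⟨a', b', rfl⟩ := mem_stepSpan_two.1 hu'
    obtain ⟨c, d, rfl⟩ := mem_stepSpan_two.1 hw
    obtain ⟨c', d', rfl⟩ := mem_stepSpan_two.1 hw'
    have m1 : upperBasis F 0 ∈ stepSpan (F := F) (upperBasis F) 2 := mem_stepSpan (by decide)
    have m2 : upperBasis F 1 ∈ stepSpan (F := F) (upperBasis F) 2 := mem_stepSpan (by decide)
    have e1 := hwu _ m1
    have e2 := hwu _ m2
    have e3 := hwu' _ m1
    have e4 := hwu' _ m2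
    simp [bform_seven, lowerBasis, upperBasis, graphBasis] at e1 e2 e3 e4 hne heq
    subst e1 e2 e3 e4
    have hd : (2 * (c * d' - d * c')) ≠ 0 := by
      intro h
      apply hne
      linear_combination h
    have hd2 : 2 * (2 * (c * d' - d * c')) ^ 2 ≠ 0 := mul_ne_zero h2 (pow_ne_zero 2 hd)
    apply mul_left_cancel₀ hd2
    linear_combination -heq
  · rintro rfl
    refine ⟨lowerBasis F 0, mem_stepSpan (by decide),
      lowerBasis F 1, mem_stepSpan (by decide),
      graphBasis l' 0, mem_stepSpan (by decide),
      graphBasis l' 1, mem_stepSpan (by decide), fun x hx => ?_, fun x hx => ?_, ?_, ?_⟩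
    · obtain ⟨a, b, rfl⟩ := mem_stepSpan_two.1 hx
      simp [bform_seven, lowerBasis, upperBasis, graphBasis]
    · obtain ⟨a, b, rfl⟩ := mem_stepSpan_two.1 hx
      simp [bform_seven, lowerBasis, upperBasis, graphBasis]
    · simp [bform_seven, lowerBasis, graphBasis]
      intro h
      apply h2
      linear_combination h
    · simp [bform_seven, lowerBasis, graphBasis]
      ring

/-- The line `L`, projected to the sum of `V₁` and `V₂`, has a norm which, compared with its
pairing with a vector of `V₁ + V₂` orthogonal to `W`, is determined by `l`. -/
def LineNorm (N : ℕ) (l : F) (V₁ V₂ L W : Submodule F (Fin N → F)) : Prop :=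
  ∃ u ∈ V₁, ∃ v ∈ V₂, ∃ u' ∈ V₁, ∃ v' ∈ V₂, ∃ w ∈ L,
    (∀ x ∈ W, bform F N u x + bform F N v x = 0) ∧
    (∀ x ∈ V₁, bform F N v' x = bform F N w x) ∧ (∀ x ∈ V₂, bform F N u' x = bform F N w x) ∧
    bform F N u v' ≠ 0 ∧
    2 * (bform F N u v * bform F N u' v') = (l - 2) * bform F N u v' ^ 2

lemma LineNorm.map {κ : Type*} {M N : ℕ} {V : κ → Submodule F (Fin M → F)}
    {V' : κ → Submodule F (Fin N → F)} (h : FormMap V V') {l : F} {i j k p : κ}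
    (hV : LineNorm M l (V i) (V j) (V k) (V p)) : LineNorm N l (V' i) (V' j) (V' k) (V' p) := by
  obtain ⟨f, hmem, hform, hback⟩ := h
  obtain ⟨u, hu, v, hv, u', hu', v', hv', w, hw, h1, h2, h3, h4, h5⟩ := hV
  refine ⟨f u, hmem _ _ hu, f v, hmem _ _ hv, f u', hmem _ _ hu', f v', hmem _ _ hv', f w,
    hmem _ _ hw, fun x hx => ?_, fun x hx => ?_, fun x hx => ?_, ?_, ?_⟩
  · obtain ⟨y, hy, hxy⟩ := hback _ x hx
    rw [hxy _ _ hu, hxy _ _ hv, h1 y hy]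
  · obtain ⟨y, hy, hxy⟩ := hback _ x hx
    rw [hxy _ _ hv', hxy _ _ hw, h2 y hy]
  · obtain ⟨y, hy, hxy⟩ := hback _ x hx
    rw [hxy _ _ hu', hxy _ _ hw, h3 y hy]
  · rwa [hform _ _ _ hu _ hv']
  · rwa [hform _ _ _ hu _ hv', hform _ _ _ hu _ hv, hform _ _ _ hu' _ hv']

/-- A basis of a fixed maximal isotropic subspace whose first member depends on `l`. -/
def lineBasis (l : F) : Fin 3 → Fin 7 → F :=
  ![![1, l, l, 2, -1, 1, -2], ![0, 1, 1, 0, 0, 0, 0], ![0, 0, 0, 0, -1, 1, 0]]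

lemma isIsotropicBasis_lineBasis (l : F) : IsIsotropicBasis (lineBasis l) := by
  refine isIsotropicBasis_of (fun a b c h => ?_) ?_ ?_ ?_ ?_ ?_ ?_
  · have h0 := congrFun h 0
    have h1 := congrFun h 1
    have h2 := congrFun h 5
    simp [lineBasis] at h0 h1 h2
    subst h0
    simpa using And.intro h1 h2
  all_goals (simp [lineBasis, bform_seven]; try ring)

lemma lineNorm_lineBasis (h2 : (2 : F) ≠ 0) (l l' : F) :
    LineNorm 7 l' (stepSpan (lowerBasis F) 2) (stepSpan (upperBasis F) 2)
      (stepSpan (lineBasis l) 1) (stepSpan (lineBasis l) 3) ↔ l' = l := by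
  have p0 : lowerBasis F 0 ∈ stepSpan (F := F) (lowerBasis F) 2 := mem_stepSpan (by decide)
  have p1 : lowerBasis F 1 ∈ stepSpan (F := F) (lowerBasis F) 2 := mem_stepSpan (by decide)
  have q0 : upperBasis F 0 ∈ stepSpan (F := F) (upperBasis F) 2 := mem_stepSpan (by decide)
  have q1 : upperBasis F 1 ∈ stepSpan (F := F) (upperBasis F) 2 := mem_stepSpan (by decide)
  constructor
  · rintro ⟨u, hu, v, hv, u', hu', v', hv', w, hw, horth, h1, h2', hne, heq⟩
    obtain ⟨a, b, rfl⟩ := mem_stepSpan_two.1 hu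
    obtain ⟨c, d, rfl⟩ := mem_stepSpan_two.1 hv
    obtain ⟨a', b', rfl⟩ := mem_stepSpan_two.1 hu'
    obtain ⟨c', d', rfl⟩ := mem_stepSpan_two.1 hv'
    obtain ⟨k, rfl⟩ := mem_stepSpan_one.1 hw
    have e0 := horth (lineBasis l 0) (mem_stepSpan (by decide))
    have e1 := horth (lineBasis l 1) (mem_stepSpan (by decide))
    have e2 := horth (lineBasis l 2) (mem_stepSpan (by decide))
    have f0 := h1 _ p0
    have f1 := h1 _ p1
    have g0 := h2' _ q0
    have g1 := h2' _ q1
    simp [bform_seven, lowerBasis, upperBasis, lineBasis] at e0 e1 e2 f0 f1 g0 g1 hne heq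
    subst f0 f1 g0 g1 e1 e2
    have hc : c = 2 * a := by linear_combination e0
    subst hc
    have hak : 2 * (a * a' * 2) ^ 2 ≠ 0 := by
      refine mul_ne_zero h2 (pow_ne_zero 2 fun h => hne ?_)
      linear_combination -h
    apply mul_left_cancel₀ hak
    linear_combination -2 * heq
  · rintro rfl
    refine ⟨lowerBasis F 0, p0, (2 : F) • upperBasis F 0, Submodule.smul_mem _ _ q0,
      lowerBasis F 0 + l' • lowerBasis F 1, add_mem p0 (Submodule.smul_mem _ _ p1),
      (-2 : F) • upperBasis F 0 + upperBasis F 1, add_mem (Submodule.smul_mem _ _ q0) q1,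
      lineBasis l' 0, mem_stepSpan (by decide), fun x hx => ?_, fun x hx => ?_,
      fun x hx => ?_, ?_, ?_⟩
    · obtain ⟨a, b, c, rfl⟩ := mem_stepSpan_three.1 hx
      simp [bform_seven, lowerBasis, upperBasis, lineBasis]
      ring
    · obtain ⟨a, b, rfl⟩ := mem_stepSpan_two.1 hx
      simp [bform_seven, lowerBasis, upperBasis, lineBasis]
    · obtain ⟨a, b, rfl⟩ := mem_stepSpan_two.1 hx
      simp [bform_seven, lowerBasis, upperBasis, lineBasis]
    · simpa [bform_seven, lowerBasis, upperBasis] using h2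
    · simp [bform_seven, lowerBasis, upperBasis]
      ring

/-- The points cut out by `W₁` and `W₂` on the projection of `V₁` to `W₃` along the orthogonal
complement of `V₂` differ by a multiple of the asymmetry of `V₁` determined by `l`. -/
def FlagShift (N : ℕ) (l : F) (V₁ V₂ W₁ W₂ W₃ : Submodule F (Fin N → F)) : Prop :=
  ∃ a ∈ V₁, ∃ b ∈ V₁, ∃ w₁ ∈ W₁, ∃ w₂ ∈ W₂, ∃ y ∈ W₃,
    (∀ x ∈ V₂, bform F N y x = bform F N a x) ∧ (∀ x ∈ V₁, bform F N w₁ x = bform F N y x) ∧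
    (∀ x ∈ V₂, bform F N w₂ x = bform F N b x) ∧
    bform F N a w₂ + bform F N b w₁ ≠ 0 ∧
    2 * (bform F N a w₂ - bform F N b w₁) = l * (bform F N a w₂ + bform F N b w₁)

lemma FlagShift.map {κ : Type*} {M N : ℕ} {V : κ → Submodule F (Fin M → F)}
    {V' : κ → Submodule F (Fin N → F)} (h : FormMap V V') {l : F} {i j k p q : κ}
    (hV : FlagShift M l (V i) (V j) (V k) (V p) (V q)) :
    FlagShift N l (V' i) (V' j) (V' k) (V' p) (V' q) := by
  obtain ⟨f, hmem, hform, hback⟩ := h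
  obtain ⟨a, ha, b, hb, w₁, hw₁, w₂, hw₂, y, hy, h1, h2, h3, h4, h5⟩ := hV
  refine ⟨f a, hmem _ _ ha, f b, hmem _ _ hb, f w₁, hmem _ _ hw₁, f w₂, hmem _ _ hw₂, f y,
    hmem _ _ hy, fun x hx => ?_, fun x hx => ?_, fun x hx => ?_, ?_, ?_⟩
  · obtain ⟨z, hz, hxz⟩ := hback _ x hx
    rw [hxz _ _ ha, hxz _ _ hy, h1 z hz]
  · obtain ⟨z, hz, hxz⟩ := hback _ x hx
    rw [hxz _ _ hw₁, hxz _ _ hy, h2 z hz]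
  · obtain ⟨z, hz, hxz⟩ := hback _ x hx
    rw [hxz _ _ hw₂, hxz _ _ hb, h3 z hz]
  · rwa [hform _ _ _ ha _ hw₂, hform _ _ _ hb _ hw₁]
  · rwa [hform _ _ _ ha _ hw₂, hform _ _ _ hb _ hw₁]

/-- A basis whose first two members pair with nontrivial asymmetry. -/
def skewBasis (F : Type*) [Field F] : Fin 3 → Fin 7 → F :=
  ![![1, 0, 0, 0, 0, 1, 0], ![0, 1, 0, 2, 0, -2, -1], ![0, 0, 1, 0, 0, 0, 0]]

/-- A basis adapted to a complete flag, depending on `l`, of a fixed maximal isotropic subspace. -/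
def flagBasis (l : F) : Fin 3 → Fin 7 → F :=
  ![![0, 0, 0, 0, 1, 0, 1], ![0, 0, 0, 0, 0, l, 1], ![0, 0, 0, 0, 0, 1, 0]]

lemma isIsotropicBasis_skewBasis : IsIsotropicBasis (skewBasis F) := by
  refine isIsotropicBasis_of (fun a b c h => ?_) ?_ ?_ ?_ ?_ ?_ ?_
  · have h0 := congrFun h 0
    have h1 := congrFun h 1
    have h2 := congrFun h 2
    simp [skewBasis] at h0 h1 h2
    exact ⟨h0, h1, h2⟩
  all_goals (simp [skewBasis, bform_seven]; try ring)

lemma isIsotropicBasis_flagBasis (l : F) : IsIsotropicBasis (flagBasis l) := by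
  refine isIsotropicBasis_of (fun a b c h => ?_) ?_ ?_ ?_ ?_ ?_ ?_
  · have h0 := congrFun h 4
    have h1 := congrFun h 6
    have h2 := congrFun h 5
    simp [flagBasis] at h0 h1 h2
    subst h0
    rw [zero_add] at h1
    subst h1
    simpa using h2
  all_goals simp [flagBasis, bform_seven]

lemma flagShift_flagBasis (h2 : (2 : F) ≠ 0) (l l' : F) :
    FlagShift 7 l' (stepSpan (skewBasis F) 2) (stepSpan (lowerBasis F) 3)
      (stepSpan (flagBasis l) 1) (stepSpan (flagBasis l) 2) (stepSpan (flagBasis l) 3) ↔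
        l' = l := by
  have p0 : skewBasis F 0 ∈ stepSpan (F := F) (skewBasis F) 2 := mem_stepSpan (by decide)
  have p1 : skewBasis F 1 ∈ stepSpan (F := F) (skewBasis F) 2 := mem_stepSpan (by decide)
  have q0 : lowerBasis F 0 ∈ stepSpan (F := F) (lowerBasis F) 3 := mem_stepSpan (by decide)
  have q1 : lowerBasis F 1 ∈ stepSpan (F := F) (lowerBasis F) 3 := mem_stepSpan (by decide)
  have q2 : lowerBasis F 2 ∈ stepSpan (F := F) (lowerBasis F) 3 := mem_stepSpan (by decide)
  constructor
  · rintro ⟨a, ha, b, hb, w₁, hw₁, w₂, hw₂, y, hy, h1, h2', h3, hne, heq⟩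
    obtain ⟨a₁, a₂, rfl⟩ := mem_stepSpan_two.1 ha
    obtain ⟨b₁, b₂, rfl⟩ := mem_stepSpan_two.1 hb
    obtain ⟨k, rfl⟩ := mem_stepSpan_one.1 hw₁
    obtain ⟨d, h, rfl⟩ := mem_stepSpan_two.1 hw₂
    obtain ⟨y₁, y₂, y₃, rfl⟩ := mem_stepSpan_three.1 hy
    have e0 := h1 _ q0
    have e1 := h1 _ q1
    have e2 := h1 _ q2
    have f0 := h2' _ p0
    have f1 := h2' _ p1
    have g0 := h3 _ q0
    have g1 := h3 _ q1
    have g2 := h3 _ q2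
    simp [bform_seven, lowerBasis, skewBasis, flagBasis] at e0 e1 e2 f0 f1 g0 g1 g2 hne heq
    subst e2 g2
    have hk : k = -a₂ := by linear_combination f0 + e0
    have ha₁ : a₁ = 2 * a₂ := by linear_combination -f1 - e1
    have hh : h = -b₂ := by linear_combination g0
    have hb₁ : b₁ = 2 * b₂ - l * b₂ := by linear_combination -g1 + l * hh
    subst hk ha₁ hh hb₁
    have hab : -4 * (a₂ * b₂) ≠ 0 := by
      intro h0
      apply hne
      linear_combination h0
    apply mul_left_cancel₀ hab
    linear_combination -heq
  · rintro rfl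
    refine ⟨(2 : F) • skewBasis F 0 + skewBasis F 1, add_mem (Submodule.smul_mem _ _ p0) p1,
      (2 - l') • skewBasis F 0 + skewBasis F 1, add_mem (Submodule.smul_mem _ _ p0) p1,
      (-1 : F) • flagBasis l' 0, Submodule.smul_mem _ _ (mem_stepSpan (by decide)),
      (-1 : F) • flagBasis l' 1, Submodule.smul_mem _ _ (mem_stepSpan (by decide)),
      (-1 : F) • flagBasis l' 1 + l' • flagBasis l' 2,
      add_mem (Submodule.smul_mem _ _ (mem_stepSpan (by decide)))
        (Submodule.smul_mem _ _ (mem_stepSpan (by decide))),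
      fun x hx => ?_, fun x hx => ?_, fun x hx => ?_, ?_, ?_⟩
    · obtain ⟨a, b, c, rfl⟩ := mem_stepSpan_three.1 hx
      simp [bform_seven, lowerBasis, skewBasis, flagBasis]
    · obtain ⟨a, b, rfl⟩ := mem_stepSpan_two.1 hx
      simp [bform_seven, skewBasis, flagBasis]
    · obtain ⟨a, b, c, rfl⟩ := mem_stepSpan_three.1 hx
      simp [bform_seven, lowerBasis, skewBasis, flagBasis]
      ring
    · simp [bform_seven, skewBasis, flagBasis]
      intro h0
      apply mul_ne_zero h2 h2
      linear_combination -h0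
    · simp [bform_seven, skewBasis, flagBasis]
      ring

end Orbits

/-- Theorem 2.20: with `a = (α)`, `b = (β)`, `c = (γ_1, …, γ_r)`,
`α ≤ β` (and `β ≤ γ_1` when `r = 1`), if the triple flag variety `M_a × M_b × M_c`
has finitely many `O_{2n+1}(F)`-orbits, then (I) `α = β = n`, (II) `α = 1`,
(III) `r = 1 ∧ γ_1 = n`, or (IV) `r = 2 ∧ β = n`. -/
theorem statement4 (F : Type*) [Field F] [Infinite F] (hchar : (2 : F) ≠ 0)
    (n : ℕ) (hn : 1 ≤ n) (α β : ℕ) (r : ℕ) (hr : 0 < r) (c : Fin r → ℕ)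
    (hα : 0 < α) (hβ : 0 < β) (hcpos : ∀ i, 0 < c i)
    (hαn : α ≤ n) (hβn : β ≤ n) (hcsum : (∑ i, c i) ≤ n)
    (hab : α ≤ β) (hbc : r = 1 → β ≤ c ⟨0, hr⟩)
    (hfin : Finite (Quot (TripleRel F n 1 1 r ![α] ![β] c))) :
    (α = n ∧ β = n) ∨ α = 1 ∨ (r = 1 ∧ c ⟨0, hr⟩ = n) ∨ (r = 2 ∧ β = n) := by
  by_contra hcon
  push Not at hcon
  obtain ⟨hI, hII, hIII, hIV⟩ := hcon
  have hα2 : 2 ≤ α := by omega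
  have hlt : α < n := by
    rcases hαn.lt_or_eq with h | h
    · exact h
    · exact absurd (le_antisymm hβn (h ▸ hab)) (hI h)
  have hn3 : 3 ≤ n := by omega
  have hdα : coreDim 1 (n - 1) α = 2 := by
    simp only [coreDim]; split_ifs <;> omega
  have hgraph : β < n → ∀ k : Fin r, 2 ≤ ∑ j ∈ Finset.Iic k, c j →
      ∑ j ∈ Finset.Iic k, c j < n → False := by
    intro hβ' k hk2 hkn
    refine not_finite_orbits (c := c) hn3 hαn hβn hcsum one_pos (t := n - 1) (by omega) (by omega)
      (fun _ => lowerBasis F) (fun _ => upperBasis F) graphBasis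
      (fun _ => isIsotropicBasis_lowerBasis) (fun _ => isIsotropicBasis_upperBasis)
      isIsotropicBasis_graphBasis
      (fun N l V => GraphDiscr N l (V (.inl 0)) (V (.inr (.inl 0))) (V (.inr (.inr k))))
      (fun M N l V V' h => GraphDiscr.map h) (fun l l' => ?_) hfin
    have hdβ : coreDim 1 (n - 1) β = 2 := by
      simp only [coreDim]; split_ifs <;> omega
    have hdk : coreDim 1 (n - 1) (∑ j ∈ Finset.Iic k, c j) = 2 := by
      simp only [coreDim]; split_ifs <;> omega
    simp only [Sum.elim_inl, Sum.elim_inr, hdα, hdβ, hdk]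
    exact graphDiscr_graphBasis hchar l l'
  have hsum0 : ∑ j ∈ Finset.Iic (⟨0, hr⟩ : Fin r), c j = c ⟨0, hr⟩ := by
    have h : Finset.Iic (⟨0, hr⟩ : Fin r) = {⟨0, hr⟩} := by
      ext j; simp [Fin.ext_iff, Fin.le_def]
    rw [h, Finset.sum_singleton]
  have hmono : ∀ i j : Fin r, i < j →
      ∑ k ∈ Finset.Iic i, c k < ∑ k ∈ Finset.Iic j, c k := by
    intro i j hij
    refine Finset.sum_lt_sum_of_subset (Finset.Iic_subset_Iic.2 hij.le) (i := j) (by simp)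
      (by simpa using hij) (hcpos j) fun _ _ _ => Nat.zero_le _
  have hle : ∀ i : Fin r, ∑ k ∈ Finset.Iic i, c k ≤ n := fun i =>
    (Finset.sum_le_sum_of_subset (Finset.subset_univ _)).trans hcsum
  have hc0 := hcpos ⟨0, hr⟩
  rcases (by omega : r = 1 ∨ r = 2 ∨ 3 ≤ r) with hr1 | hr2 | hr3
  · have h1 := hbc hr1
    have h2 := hIII hr1
    have h3 := hle ⟨0, hr⟩
    exact hgraph (by omega) ⟨0, hr⟩ (by omega) (by omega)
  · have hβ' : β < n := lt_of_le_of_ne hβn (hIV hr2)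
    have h01 := hmono ⟨0, hr⟩ ⟨1, by omega⟩ (by simp [Fin.lt_def])
    have h1 := hle ⟨1, by omega⟩
    by_cases hlt1 : ∑ j ∈ Finset.Iic (⟨1, by omega⟩ : Fin r), c j < n
    · exact hgraph hβ' ⟨1, by omega⟩ (by omega) hlt1
    by_cases h2 : 2 ≤ ∑ j ∈ Finset.Iic (⟨0, hr⟩ : Fin r), c j
    · exact hgraph hβ' ⟨0, hr⟩ h2 (by omega)
    refine not_finite_orbits (c := c) hn3 hαn hβn hcsum one_pos (t := n - 1) (by omega) (by omega)
      (fun _ => lowerBasis F) (fun _ => upperBasis F) lineBasis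
      (fun _ => isIsotropicBasis_lowerBasis) (fun _ => isIsotropicBasis_upperBasis)
      isIsotropicBasis_lineBasis
      (fun N l V => LineNorm N l (V (.inl 0)) (V (.inr (.inl 0)))
        (V (.inr (.inr ⟨0, hr⟩))) (V (.inr (.inr ⟨1, by omega⟩))))
      (fun M N l V V' h => LineNorm.map h) (fun l l' => ?_) hfin
    have hdβ : coreDim 1 (n - 1) β = 2 := by
      simp only [coreDim]; split_ifs <;> omega
    have hd0 : coreDim 1 (n - 1) (∑ j ∈ Finset.Iic (⟨0, hr⟩ : Fin r), c j) = 1 := by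
      simp only [coreDim]; split_ifs <;> omega
    have hd1 : coreDim 1 (n - 1) (∑ j ∈ Finset.Iic (⟨1, by omega⟩ : Fin r), c j) = 3 := by
      simp only [coreDim]; split_ifs <;> omega
    simp only [Sum.elim_inl, Sum.elim_inr, hdα, hdβ, hd0, hd1]
    exact lineNorm_lineBasis hchar l l'
  · have h01 := hmono ⟨0, hr⟩ ⟨1, by omega⟩ (by simp [Fin.lt_def])
    have h12 := hmono ⟨1, by omega⟩ ⟨2, by omega⟩ (by simp [Fin.lt_def])
    have h2 := hle ⟨2, by omega⟩
    rcases hβn.lt_or_eq with hβ' | hβ'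
    · exact hgraph hβ' ⟨1, by omega⟩ (by omega) (by omega)
    refine not_finite_orbits (c := c) hn3 hαn hβn hcsum
      (s := ∑ j ∈ Finset.Iic (⟨0, hr⟩ : Fin r), c j)
      (t := ∑ j ∈ Finset.Iic (⟨1, by omega⟩ : Fin r), c j) (by omega) h01 (by omega)
      (fun _ => skewBasis F) (fun _ => lowerBasis F) flagBasis
      (fun _ => isIsotropicBasis_skewBasis) (fun _ => isIsotropicBasis_lowerBasis)
      isIsotropicBasis_flagBasis
      (fun N l V => FlagShift N l (V (.inl 0)) (V (.inr (.inl 0))) (V (.inr (.inr ⟨0, hr⟩)))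
        (V (.inr (.inr ⟨1, by omega⟩))) (V (.inr (.inr ⟨2, by omega⟩))))
      (fun M N l V V' h => FlagShift.map h) (fun l l' => ?_) hfin
    have hdβ : coreDim 1 (n - 1) β = 3 := by
      simp only [coreDim]; split_ifs <;> omega
    generalize hs0 : ∑ j ∈ Finset.Iic (⟨0, hr⟩ : Fin r), c j = s₀ at *
    generalize hs1 : ∑ j ∈ Finset.Iic (⟨1, by omega⟩ : Fin r), c j = s₁ at *
    generalize hs2 : ∑ j ∈ Finset.Iic (⟨2, by omega⟩ : Fin r), c j = s₂ at *
    have hd0 : coreDim s₀ s₁ s₀ = 1 := by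
      simp only [coreDim]; split_ifs <;> omega
    have hd1 : coreDim s₀ s₁ s₁ = 2 := by
      simp only [coreDim]; split_ifs <;> omega
    have hd2 : coreDim s₀ s₁ s₂ = 3 := by
      simp only [coreDim]; split_ifs <;> omega
    simp only [Sum.elim_inl, Sum.elim_inr, hdα, hdβ, hs0, hs1, hs2, hd0, hd1, hd2]
    exact flagShift_flagBasis hchar l l'
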